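/- Let n ≥ 1 and let g_1, ..., g_n : ℝ → [0,∞] be symmetrically decreasing functions with 0 ≤ g_j ≤ 1 and ∫_ℝ g_j(t) dt = 1 for all 1 ≤ j ≤ n. If ∫_ℝ h(x) (g_1 ∗ ⋯ ∗ g_n)(x) dx = ∫_ℝ h(x) M_n(x) dx for every symmetrically decreasing function h : ℝ → [0,∞], then g_j = M_1 almost everywhere for every 1 ≤ j ≤ n. -/

import Mathlib

open MeasureTheory Set

/-- Convolution of `[0,∞]`-valued functions on `ℝ`. -/
noncomputable def conv (f g : ℝ → ENNReal) (x : ℝ) : ENNReal := ∫⁻ y, f (x - y) * g y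

/-- A function `f : ℝ → [0,∞]` is symmetrically decreasing if `f(-x) = f(x)` for all `x`
and `f(y) ≤ f(x)` whenever `0 < x < y`. -/
def SymmDecr (f : ℝ → ENNReal) : Prop :=
  (∀ x : ℝ, f (-x) = f x) ∧ ∀ x y : ℝ, 0 < x → x < y → f y ≤ f x

/-- `M₁ = 1_{(−1/2, 1/2)}` as a `[0,∞]`-valued function. -/
noncomputable def M1 : ℝ → ENNReal := (Set.Ioo (-(1:ℝ)/2) (1/2)).indicator (fun _ => 1)

/-- Iterated convolution `g_0 ∗ g_1 ∗ ⋯ ∗ g_k`. -/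
noncomputable def iterConv (g : ℕ → ℝ → ENNReal) : ℕ → ℝ → ENNReal
  | 0 => g 0
  | k + 1 => conv (iterConv g k) (g (k + 1))

/-- The centered cardinal B-spline: `Mspline 0 = M₁`, `Mspline k = M₁ ∗ ⋯ ∗ M₁`
((k+1)-fold convolution), so that `Mspline (n-1)` is the B-spline `M_n` of order `n`. -/
noncomputable def Mspline : ℕ → ℝ → ENNReal
  | 0 => M1
  | k + 1 => conv (Mspline k) M1

theorem SymmDecr.measurable {f : ℝ → ENNReal} (hf : SymmDecr f) : Measurable f := by
  classical
  have hk : Antitone (fun x : ℝ => if x ≤ 0 then ⊤ else f x) := by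
    intro x y hxy
    dsimp only
    split_ifs with h1 h2 h2
    · exact le_rfl
    · exact absurd (hxy.trans h1) h2
    · exact le_top
    · rcases hxy.eq_or_lt with rfl | h
      · exact le_rfl
      · exact hf.2 x y (not_le.mp h2) h
  have heq : f = fun x => if x = 0 then f 0 else if |x| ≤ 0 then ⊤ else f |x| := by
    funext x
    rcases lt_trichotomy x 0 with h | rfl | h
    · simp [h.ne, abs_of_neg h, hf.1, h]
    · simp
    · simp [h.ne', abs_of_pos h, h]
  rw [heq]
  exact Measurable.ite (measurableSet_singleton 0) measurable_const
    (hk.measurable.comp measurable_norm)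

theorem measurable_conv {f g : ℝ → ENNReal} (hf : Measurable f) (hg : Measurable g) :
    Measurable (conv f g) := by
  exact Measurable.lintegral_prod_right' (f := fun p : ℝ × ℝ => f (p.1 - p.2) * g p.2)
    (by fun_prop)

theorem lintegral_mul_conv {f g φ : ℝ → ENNReal} (hf : Measurable f) (hg : Measurable g)
    (hφ : Measurable φ) :
    ∫⁻ x, φ x * conv f g x = ∫⁻ y, ∫⁻ x, φ (x + y) * (f x * g y) := by
  have h (x : ℝ) : φ x * conv f g x = ∫⁻ y, φ x * (f (x - y) * g y) :=
    (lintegral_const_mul _ (by fun_prop)).symm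
  simp_rw [h]
  rw [lintegral_lintegral_swap (by fun_prop)]
  congr 1 with y
  rw [← lintegral_add_right_eq_self _ y]
  simp

theorem lintegral_conv {f g : ℝ → ENNReal} (hf : Measurable f) (hg : Measurable g) :
    ∫⁻ x, conv f g x = (∫⁻ x, f x) * ∫⁻ x, g x := by
  have h := lintegral_mul_conv hf hg (φ := fun _ => 1) measurable_const
  simp only [one_mul] at h
  rw [h, ← lintegral_const_mul _ hg]
  congr 1 with y
  rw [lintegral_mul_const _ hf]

/-- The second moment `∫ x² f(x) dx`. -/
noncomputable def secondMoment (f : ℝ → ENNReal) : ENNReal := ∫⁻ x, ENNReal.ofReal (x ^ 2) * f x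

theorem secondMoment_conv {f g : ℝ → ENNReal} (hf : Measurable f) (hg : Measurable g)
    (hsymm : ∀ x, g (-x) = g x) (hf1 : ∫⁻ x, f x = 1) (hg1 : ∫⁻ x, g x = 1) :
    secondMoment (conv f g) = secondMoment f + secondMoment g := by
  have h1 := lintegral_mul_conv hf hg (φ := fun x => ENNReal.ofReal (x ^ 2)) (by fun_prop)
  have h2 : ∫⁻ y, ∫⁻ x, ENNReal.ofReal ((x + y) ^ 2) * (f x * g y)
      = ∫⁻ y, ∫⁻ x, ENNReal.ofReal ((x - y) ^ 2) * (f x * g y) := by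
    rw [← lintegral_neg_eq_self]
    simp [hsymm, sub_eq_add_neg]
  have hpt (x y : ℝ) : ENNReal.ofReal ((x + y) ^ 2) * (f x * g y)
      + ENNReal.ofReal ((x - y) ^ 2) * (f x * g y)
      = 2 * (ENNReal.ofReal (x ^ 2) * f x * g y + ENNReal.ofReal (y ^ 2) * g y * f x) := by
    rw [← add_mul, ← ENNReal.ofReal_add (by positivity) (by positivity),
      show (x + y) ^ 2 + (x - y) ^ 2 = 2 * (x ^ 2 + y ^ 2) by ring,
      ENNReal.ofReal_mul (by norm_num), ENNReal.ofReal_add (by positivity) (by positivity)]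
    simp only [ENNReal.ofReal_ofNat]
    ring
  have hin (y : ℝ) :
      ∫⁻ x, (ENNReal.ofReal (x ^ 2) * f x * g y + ENNReal.ofReal (y ^ 2) * g y * f x) =
        secondMoment f * g y + ENNReal.ofReal (y ^ 2) * g y := by
    rw [lintegral_add_left (by fun_prop), lintegral_mul_const _ (by fun_prop),
      lintegral_const_mul _ hf, hf1, mul_one, secondMoment]
  have h3 : secondMoment (conv f g) + secondMoment (conv f g)
      = 2 * (secondMoment f + secondMoment g) := by
    nth_rw 2 [secondMoment]
    rw [secondMoment, h1]
    nth_rw 2 [h2]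
    rw [← lintegral_add_left (Measurable.lintegral_prod_right'
      (f := fun p : ℝ × ℝ => ENNReal.ofReal ((p.2 + p.1) ^ 2) * (f p.2 * g p.1)) (by fun_prop))]
    calc _ = ∫⁻ y, 2 * (secondMoment f * g y + ENNReal.ofReal (y ^ 2) * g y) := by
          congr 1 with y
          rw [← lintegral_add_left (by fun_prop), ← hin, ← lintegral_const_mul _ (by fun_prop)]
          simp_rw [hpt]
      _ = _ := by
          rw [lintegral_const_mul _ (by fun_prop), lintegral_add_left (by fun_prop),
            lintegral_const_mul _ hg, hg1, mul_one, ← secondMoment]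
  rw [← two_mul] at h3
  exact (ENNReal.mul_right_inj (by norm_num) (by norm_num)).mp h3

theorem iterConv_moments {g : ℕ → ℝ → ENNReal} (k : ℕ) (hg : ∀ j ≤ k, SymmDecr (g j))
    (hint : ∀ j ≤ k, ∫⁻ x, g j x = 1) :
    Measurable (iterConv g k) ∧ ∫⁻ x, iterConv g k x = 1 ∧
      secondMoment (iterConv g k) = ∑ j ∈ Finset.range (k + 1), secondMoment (g j) := by
  induction k with
  | zero => simpa [iterConv] using ⟨(hg 0 le_rfl).measurable, hint 0 le_rfl⟩
  | succ k ih =>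
    obtain ⟨hm, h1, h2⟩ := ih (fun j hj => hg j (hj.trans k.le_succ))
      (fun j hj => hint j (hj.trans k.le_succ))
    have hgk := hg (k + 1) le_rfl
    have hik := hint (k + 1) le_rfl
    refine ⟨measurable_conv hm hgk.measurable, ?_, ?_⟩
    · rw [iterConv, lintegral_conv hm hgk.measurable, h1, hik, one_mul]
    · rw [iterConv, secondMoment_conv hm hgk.measurable hgk.1 h1 hik, h2,
        Finset.sum_range_succ _ (k + 1)]

theorem Mspline_eq_iterConv (k : ℕ) : Mspline k = iterConv (fun _ => M1) k := by
  induction k with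
  | zero => rfl
  | succ k ih => rw [Mspline, iterConv, ih]

theorem symmDecr_M1 : SymmDecr M1 := by
  refine ⟨fun x => ?_, fun x y hx hxy => ?_⟩
  · unfold M1
    simp only [Set.indicator, Set.mem_Ioo]
    congr 1
    apply propext
    constructor <;> rintro ⟨h1, h2⟩ <;> constructor <;> linarith
  · unfold M1
    by_cases hmem : y ∈ Set.Ioo (-(1:ℝ)/2) (1/2)
    · have hmem' : x ∈ Set.Ioo (-(1:ℝ)/2) (1/2) := ⟨by linarith, hxy.trans hmem.2⟩
      rw [Set.indicator_of_mem hmem, Set.indicator_of_mem hmem']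
    · rw [Set.indicator_of_notMem hmem]
      exact zero_le

theorem lintegral_M1 : ∫⁻ x, M1 x = 1 := by
  rw [M1, lintegral_indicator_const measurableSet_Ioo, Real.volume_Ioo]
  norm_num

theorem secondMoment_M1_ne_top : secondMoment M1 ≠ ⊤ := by
  refine ne_top_of_le_ne_top ENNReal.one_ne_top
    (le_of_le_of_eq (lintegral_mono fun x => ?_) lintegral_M1)
  unfold M1
  by_cases hx : x ∈ Set.Ioo (-(1:ℝ)/2) (1/2)
  · simp only [Set.indicator_of_mem hx, mul_one]
    rw [ENNReal.ofReal_le_one]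
    nlinarith [hx.1, hx.2]
  · simp only [Set.indicator_of_notMem hx, mul_zero, le_refl]

theorem ofReal_sq_mul_M1_add_le {x : ℝ} {a : ENNReal} (ha : a ≤ 1) :
    ENNReal.ofReal (x ^ 2) * M1 x + ENNReal.ofReal (1 / 4) * a
      ≤ ENNReal.ofReal (x ^ 2) * a + ENNReal.ofReal (1 / 4) * M1 x ∧
    (|x| ≠ 1 / 2 → ENNReal.ofReal (x ^ 2) * M1 x + ENNReal.ofReal (1 / 4) * a
      = ENNReal.ofReal (x ^ 2) * a + ENNReal.ofReal (1 / 4) * M1 x → a = M1 x) := by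
  obtain ⟨r, hr0, rfl⟩ : ∃ r : ℝ, 0 ≤ r ∧ a = ENNReal.ofReal r :=
    ⟨a.toReal, ENNReal.toReal_nonneg,
      (ENNReal.ofReal_toReal (ne_top_of_le_ne_top ENNReal.one_ne_top ha)).symm⟩
  have hr1 : r ≤ 1 := ENNReal.ofReal_le_one.mp ha
  have h4 : (0 : ℝ) ≤ 1 / 4 := by norm_num
  have hx2 := sq_nonneg x
  unfold M1
  by_cases hx : x ∈ Set.Ioo (-(1:ℝ)/2) (1/2)
  · have hlt : x ^ 2 < 1 / 4 := by nlinarith [hx.1, hx.2]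
    simp only [Set.indicator_of_mem hx, mul_one]
    rw [← ENNReal.ofReal_mul h4, ← ENNReal.ofReal_mul hx2,
      ← ENNReal.ofReal_add hx2 (by positivity), ← ENNReal.ofReal_add (by positivity) h4,
      ENNReal.ofReal_le_ofReal_iff (by positivity),
      ENNReal.ofReal_eq_ofReal_iff (by positivity) (by positivity)]
    refine ⟨by nlinarith, fun _ h => ?_⟩
    rw [ENNReal.ofReal_eq_one]
    have : (1 / 4 - x ^ 2) * (r - 1) = 0 := by linarith
    rcases mul_eq_zero.mp this with h | h <;> linarith
  · have hge : 1 / 2 ≤ |x| := by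
      by_contra! h
      exact hx ⟨by linarith [neg_abs_le x], by linarith [le_abs_self x]⟩
    have hge2 : 1 / 4 ≤ x ^ 2 := by rw [← sq_abs]; nlinarith
    simp only [Set.indicator_of_notMem hx, mul_zero, zero_add, add_zero]
    rw [← ENNReal.ofReal_mul h4, ← ENNReal.ofReal_mul hx2,
      ENNReal.ofReal_le_ofReal_iff (by positivity),
      ENNReal.ofReal_eq_ofReal_iff (by positivity) (by positivity)]
    refine ⟨by nlinarith, fun hne h => ?_⟩
    rw [ENNReal.ofReal_eq_zero]
    have hgt : 1 / 4 < x ^ 2 := by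
      rw [← sq_abs]; nlinarith [lt_of_le_of_ne hge hne.symm]
    have : (x ^ 2 - 1 / 4) * r = 0 := by linarith
    rcases mul_eq_zero.mp this with h | h <;> linarith

theorem secondMoment_M1_le {g : ℝ → ENNReal} (hm : Measurable g) (hg1 : ∀ x, g x ≤ 1)
    (hgint : ∫⁻ x, g x = 1) :
    secondMoment M1 ≤ secondMoment g ∧
      (secondMoment g ≤ secondMoment M1 → g =ᵐ[volume] M1) := by
  have hM := symmDecr_M1.measurable
  have hL : ∫⁻ x, (ENNReal.ofReal (x ^ 2) * M1 x + ENNReal.ofReal (1 / 4) * g x)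
      = secondMoment M1 + ENNReal.ofReal (1 / 4) := by
    rw [lintegral_add_left (by fun_prop), lintegral_const_mul _ hm, hgint, mul_one, secondMoment]
  have hR : ∫⁻ x, (ENNReal.ofReal (x ^ 2) * g x + ENNReal.ofReal (1 / 4) * M1 x)
      = secondMoment g + ENNReal.ofReal (1 / 4) := by
    rw [lintegral_add_left (by fun_prop), lintegral_const_mul _ hM, lintegral_M1, mul_one,
      secondMoment]
  refine ⟨?_, fun h => ?_⟩
  · have := lintegral_mono (μ := volume) fun x => (ofReal_sq_mul_M1_add_le (x := x) (hg1 x)).1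
    rw [hL, hR] at this
    exact (ENNReal.add_le_add_iff_right ENNReal.ofReal_ne_top).mp this
  · have hae := ae_eq_of_ae_le_of_lintegral_le
      (Filter.Eventually.of_forall fun x => (ofReal_sq_mul_M1_add_le (x := x) (hg1 x)).1)
      (by rw [hL]; exact ENNReal.add_ne_top.mpr ⟨secondMoment_M1_ne_top, ENNReal.ofReal_ne_top⟩)
      (by fun_prop) (by rw [hL, hR]; gcongr)
    have hfin : ∀ᵐ x : ℝ, x ∉ ({1 / 2, -(1 / 2)} : Set ℝ) :=
      (Set.toFinite _).countable.ae_notMem volume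
    filter_upwards [hae, hfin] with x hx hx'
    refine (ofReal_sq_mul_M1_add_le (hg1 x)).2 (fun habs => hx' ?_) hx
    exact (abs_eq (by norm_num)).mp habs

theorem symmDecr_ofReal_sub_sq (R : ℝ) : SymmDecr fun x => ENNReal.ofReal (R - x ^ 2) :=
  ⟨fun x => by simp, fun x y hx hxy => ENNReal.ofReal_le_ofReal (by nlinarith)⟩

/-- Comparison of integrals against all symmetrically decreasing functions passes to the second
moment, through the truncations `min (x², R) = R - (R - x²)⁺`. -/
theorem secondMoment_le_of_forall_symmDecr {F G : ℝ → ENNReal} (hF : Measurable F)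
    (hG : Measurable G) (hF1 : ∫⁻ x, F x = 1) (hG1 : ∫⁻ x, G x = 1)
    (h : ∀ φ : ℝ → ENNReal, SymmDecr φ → ∫⁻ x, φ x * F x = ∫⁻ x, φ x * G x) :
    secondMoment F ≤ secondMoment G := by
  have hsplit (R : ℕ) (K : ℝ → ENNReal) (hK : Measurable K) (hK1 : ∫⁻ x, K x = 1) :
      (∫⁻ x, ENNReal.ofReal (R - x ^ 2) * K x) + ∫⁻ x, ENNReal.ofReal (min (x ^ 2) R) * K x
        = ENNReal.ofReal R := by
    rw [← lintegral_add_left (by fun_prop), ← mul_one (ENNReal.ofReal R), ← hK1,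
      ← lintegral_const_mul _ hK]
    congr 1 with x
    rw [← add_mul]
    congr 1
    have hR : (0 : ℝ) ≤ R := R.cast_nonneg
    rcases le_total (x ^ 2) R with hx | hx
    · rw [min_eq_left hx, ← ENNReal.ofReal_add (by linarith) (sq_nonneg x)]
      simp
    · rw [min_eq_right hx, ENNReal.ofReal_of_nonpos (by linarith), zero_add]
  have htrunc (R : ℕ) : ∫⁻ x, ENNReal.ofReal (min (x ^ 2) R) * F x ≤ secondMoment G := by
    have hne : ∫⁻ x, ENNReal.ofReal (R - x ^ 2) * F x ≠ ⊤ :=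
      ne_top_of_le_ne_top ENNReal.ofReal_ne_top (le_self_add.trans (hsplit R F hF hF1).le)
    have heq := (hsplit R F hF hF1).trans (hsplit R G hG hG1).symm
    rw [← h _ (symmDecr_ofReal_sub_sq R)] at heq
    rw [(ENNReal.add_right_inj hne).mp heq]
    refine lintegral_mono fun x => ?_
    dsimp only
    gcongr
    exact min_le_left _ _
  have hsup : secondMoment F = ⨆ R : ℕ, ∫⁻ x, ENNReal.ofReal (min (x ^ 2) R) * F x := by
    rw [← lintegral_iSup (fun R => by fun_prop)]
    · refine lintegral_congr fun x => le_antisymm ?_ (iSup_le fun R => ?_)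
      · obtain ⟨R, hR⟩ := exists_nat_ge (x ^ 2)
        refine le_iSup_of_le R ?_
        rw [min_eq_left hR]
      · gcongr
        exact min_le_left _ _
    · intro R S hRS x
      dsimp only
      gcongr
  rw [hsup]
  exact iSup_le htrunc

theorem iterated_conv_equality_case (n : ℕ) (hn : 1 ≤ n)
    (g : ℕ → ℝ → ENNReal)
    (hgsd : ∀ j, j < n → SymmDecr (g j))
    (hg1 : ∀ j, j < n → ∀ x, g j x ≤ 1)
    (hgint : ∀ j, j < n → ∫⁻ x, g j x = 1)
    (heq : ∀ h : ℝ → ENNReal, SymmDecr h →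
      ∫⁻ x, h x * iterConv g (n - 1) x = ∫⁻ x, h x * Mspline (n - 1) x) :
    ∀ j, j < n → g j =ᵐ[volume] M1 := by
  obtain ⟨k, rfl⟩ : ∃ k, n = k + 1 := ⟨n - 1, by omega⟩
  rw [Nat.add_sub_cancel, Mspline_eq_iterConv] at heq
  obtain ⟨hm, hone, hsum⟩ := iterConv_moments k (fun j hj => hgsd j (by omega))
    (fun j hj => hgint j (by omega))
  obtain ⟨hm', hone', hsum'⟩ := iterConv_moments (g := fun _ => M1) k (fun _ _ => symmDecr_M1)
    (fun _ _ => lintegral_M1)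
  have hle := secondMoment_le_of_forall_symmDecr hm hm' hone hone' heq
  rw [hsum, hsum'] at hle
  have hmin (j : ℕ) (hj : j < k + 1) :=
    secondMoment_M1_le (hgsd j hj).measurable (hg1 j hj) (hgint j hj)
  intro j hj
  refine (hmin j hj).2 ?_
  have hmem := Finset.mem_range.mpr hj
  rw [← Finset.add_sum_erase _ _ hmem, ← Finset.add_sum_erase _ (fun _ => secondMoment M1) hmem]
    at hle
  have hrest : ∑ _i ∈ (Finset.range (k + 1)).erase j, secondMoment M1
      ≤ ∑ i ∈ (Finset.range (k + 1)).erase j, secondMoment (g i) :=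
    Finset.sum_le_sum fun i hi => (hmin i (Finset.mem_range.mp (Finset.mem_of_mem_erase hi))).1
  have hfin : ∑ _i ∈ (Finset.range (k + 1)).erase j, secondMoment M1 ≠ ⊤ :=
    ENNReal.sum_ne_top.mpr fun _ _ => secondMoment_M1_ne_top
  exact (ENNReal.add_le_add_iff_right hfin).mp ((add_le_add_right hrest _).trans hle)
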